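/- arXiv:0808.2383 — 5 statements merged into one kernel-verified Lean document; each statement's English description precedes it below -/
import Mathlib

section
/- Fix 2 ≤ d ≤ n and let λ be a nonnegative real-valued weight on the d-element subsets of Fin n such that any two distinct d-element subsets X, Y with λ(X) > 0 and λ(Y) > 0 satisfy |X ∩ Y| ≤ d − 2. Then λ satisfies the three-term tropical Plücker relations, i.e., for every (d−2)-element subset S of Fin n and all pairwise distinct elements i, j, k, l of Fin n not in S, the minimum of the three real numbers λ(S∪{i,j})+λ(S∪{k,l}), λ(S∪{i,k})+λ(S∪{j,l}), λ(S∪{i,l})+λ(S∪{j,k}) is attained at least twice. -/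
/-- At least two of the three real numbers `a`, `b`, `c` are equal to their minimum. -/
def MinAttainedTwice (a b c : ℝ) : Prop :=
  (a = min a (min b c) ∧ b = min a (min b c)) ∨
  (a = min a (min b c) ∧ c = min a (min b c)) ∨
  (b = min a (min b c) ∧ c = min a (min b c))

/-- A weight on the `d`-element subsets of `Fin n` satisfies the three-term tropical
Plücker relations. -/
def TropicalPluckerRelations (n d : ℕ) (lam : {X : Finset (Fin n) // X.card = d} → ℝ) : Prop :=
  ∀ S : Finset (Fin n), S.card = d - 2 →
    ∀ i j k l : Fin n,
      i ∉ S → j ∉ S → k ∉ S → l ∉ S →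
      i ≠ j → i ≠ k → i ≠ l → j ≠ k → j ≠ l → k ≠ l →
      ∀ (hij : (S ∪ {i, j}).card = d) (hkl : (S ∪ {k, l}).card = d)
        (hik : (S ∪ {i, k}).card = d) (hjl : (S ∪ {j, l}).card = d)
        (hil : (S ∪ {i, l}).card = d) (hjk : (S ∪ {j, k}).card = d),
        MinAttainedTwice
          (lam ⟨S ∪ {i, j}, hij⟩ + lam ⟨S ∪ {k, l}, hkl⟩)
          (lam ⟨S ∪ {i, k}, hik⟩ + lam ⟨S ∪ {j, l}, hjl⟩)
          (lam ⟨S ∪ {i, l}, hil⟩ + lam ⟨S ∪ {j, k}, hjk⟩)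

/-- If at most one of three nonnegative reals is nonzero, their minimum is attained twice. -/
theorem minAttainedTwice_of_pairwise_zero {a b c : ℝ} (ha : 0 ≤ a) (hb : 0 ≤ b) (hc : 0 ≤ c)
    (hab : a = 0 ∨ b = 0) (hac : a = 0 ∨ c = 0) (hbc : b = 0 ∨ c = 0) :
    MinAttainedTwice a b c := by
  unfold MinAttainedTwice
  grind

/-- Of two sums, one vanishes as soon as every cross pair of summands has a
vanishing member. -/
theorem add_eq_zero_or_add_eq_zero {p q r s : ℝ}
    (hpr : p = 0 ∨ r = 0) (hps : p = 0 ∨ s = 0) (hqr : q = 0 ∨ r = 0) (hqs : q = 0 ∨ s = 0) :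
    p + q = 0 ∨ r + s = 0 := by
  grind

/-- If the support of a nonnegative weight is stable, the weight vanishes on one of any two
distinct `d`-sets that share a `(d-2)`-set and a further element. -/
theorem eq_zero_or_eq_zero_of_common_insert {n d : ℕ}
    {lam : {X : Finset (Fin n) // X.card = d} → ℝ} (hnonneg : ∀ X, 0 ≤ lam X)
    (hstable : ∀ X Y : {X : Finset (Fin n) // X.card = d}, X ≠ Y →
      0 < lam X → 0 < lam Y → ((X : Finset (Fin n)) ∩ (Y : Finset (Fin n))).card ≤ d - 2)
    {S : Finset (Fin n)} (hS : S.card = d - 2) {a b : Fin n} (ha : a ∉ S)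
    {X Y : Finset (Fin n)} (hX : X.card = d) (hY : Y.card = d)
    (haX : insert a S ⊆ X) (haY : insert a S ⊆ Y) (hbX : b ∈ X) (hbY : b ∉ Y) :
    lam ⟨X, hX⟩ = 0 ∨ lam ⟨Y, hY⟩ = 0 := by
  by_contra! h
  have hne : (⟨X, hX⟩ : {X : Finset (Fin n) // X.card = d}) ≠ ⟨Y, hY⟩ := by
    intro hXY
    exact hbY (Subtype.mk.inj hXY ▸ hbX)
  have hle : (X ∩ Y).card ≤ d - 2 := hstable _ _ hne
    ((hnonneg _).lt_of_ne' h.1) ((hnonneg _).lt_of_ne' h.2)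
  have hcard := Finset.card_le_card (Finset.subset_inter haX haY)
  rw [Finset.card_insert_of_notMem ha] at hcard
  omega

/-- Corollary 3.5 of "How to draw tropical planes": a nonnegative weight whose support
is a stable set of the edge graph of the hypersimplex `Δ(d,n)` (any two sets in the
support meet in at most `d-2` elements) lies in the Dressian `Dr(d,n)`. -/
theorem stable_support_in_dressian (n d : ℕ) (hd : 2 ≤ d) (hdn : d ≤ n)
    (lam : {X : Finset (Fin n) // X.card = d} → ℝ)
    (hnonneg : ∀ X, 0 ≤ lam X)
    (hstable : ∀ X Y : {X : Finset (Fin n) // X.card = d}, X ≠ Y →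
      0 < lam X → 0 < lam Y → ((X : Finset (Fin n)) ∩ (Y : Finset (Fin n))).card ≤ d - 2) :
    TropicalPluckerRelations n d lam := by
  intro S hS i j k l hi hj hk hl nij nik nil njk njl nkl hij hkl hik hjl hil hjk
  have key {a b : Fin n} (ha : a ∉ S) {X Y : Finset (Fin n)} (hX : X.card = d)
      (hY : Y.card = d) (haX : insert a S ⊆ X) (haY : insert a S ⊆ Y) (hbX : b ∈ X)
      (hbY : b ∉ Y) : lam ⟨X, hX⟩ = 0 ∨ lam ⟨Y, hY⟩ = 0 :=
    eq_zero_or_eq_zero_of_common_insert hnonneg hstable hS ha hX hY haX haY hbX hbY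
  refine minAttainedTwice_of_pairwise_zero
    (add_nonneg (hnonneg _) (hnonneg _)) (add_nonneg (hnonneg _) (hnonneg _))
    (add_nonneg (hnonneg _) (hnonneg _))
    (add_eq_zero_or_add_eq_zero
      (key (a := i) (b := j) hi _ _ ?_ ?_ ?_ ?_) (key (a := j) (b := i) hj _ _ ?_ ?_ ?_ ?_)
      (key (a := k) (b := l) hk _ _ ?_ ?_ ?_ ?_) (key (a := l) (b := k) hl _ _ ?_ ?_ ?_ ?_))
    (add_eq_zero_or_add_eq_zero
      (key (a := i) (b := j) hi _ _ ?_ ?_ ?_ ?_) (key (a := j) (b := i) hj _ _ ?_ ?_ ?_ ?_)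
      (key (a := l) (b := k) hl _ _ ?_ ?_ ?_ ?_) (key (a := k) (b := l) hk _ _ ?_ ?_ ?_ ?_))
    (add_eq_zero_or_add_eq_zero
      (key (a := i) (b := k) hi _ _ ?_ ?_ ?_ ?_) (key (a := k) (b := i) hk _ _ ?_ ?_ ?_ ?_)
      (key (a := l) (b := j) hl _ _ ?_ ?_ ?_ ?_) (key (a := j) (b := l) hj _ _ ?_ ?_ ?_ ?_)) <;>
    (clear key hstable hnonneg; grind)
end

section
/- For every natural number n ≥ 1 there exists a family F of 3-element subsets of Fin n such that any two distinct members of F intersect in at most one element, and such that 24·|F| ≥ (n−1)(n−3) holds (as an inequality of rationals, where the right-hand side may be negative for small n). -/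
section ZeroSumTriples

variable {G : Type*} [AddCommGroup G] [DecidableEq G]

/-- A zero-sum triple is determined by any two of its elements. -/
theorem Finset.eq_insert_insert_neg_of_sum_eq_zero {X : Finset G} (hcard : X.card = 3)
    (hsum : ∑ g ∈ X, g = 0) {x y : G} (hx : x ∈ X) (hy : y ∈ X) (hxy : x ≠ y) :
    X = {x, y, -x - y} := by
  have hy' : y ∈ X.erase x := Finset.mem_erase.2 ⟨hxy.symm, hy⟩
  have hone : ((X.erase x).erase y).card = 1 := by
    rw [Finset.card_erase_of_mem hy', Finset.card_erase_of_mem hx, hcard]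
  obtain ⟨z, hz⟩ := Finset.card_eq_one.1 hone
  have hs : x + (y + z) = 0 := by
    rw [← hsum, ← Finset.add_sum_erase X (fun g => g) hx,
      ← Finset.add_sum_erase (X.erase x) (fun g => g) hy', hz, Finset.sum_singleton]
  have hz' : z = -x - y := by
    rw [eq_sub_iff_add_eq, eq_neg_iff_add_eq_zero, ← hs]
    abel
  rw [← hz', ← hz, Finset.insert_erase hy', Finset.insert_erase hx]

variable [Fintype G]

variable (G) in
/-- The 3-element subsets of a finite abelian group whose elements sum to zero. -/
def zeroSumTriples : Finset (Finset G) :=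
  {X | X.card = 3 ∧ ∑ g ∈ X, g = 0}

theorem mem_zeroSumTriples {X : Finset G} :
    X ∈ zeroSumTriples G ↔ X.card = 3 ∧ ∑ g ∈ X, g = 0 := by
  simp [zeroSumTriples]

theorem card_inter_le_one_of_mem_zeroSumTriples {X Y : Finset G} (hX : X ∈ zeroSumTriples G)
    (hY : Y ∈ zeroSumTriples G) (hXY : X ≠ Y) : (X ∩ Y).card ≤ 1 := by
  rw [mem_zeroSumTriples] at hX hY
  by_contra! h
  obtain ⟨x, hx, y, hy, hxy⟩ := Finset.one_lt_card.1 h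
  rw [Finset.mem_inter] at hx hy
  exact hXY ((Finset.eq_insert_insert_neg_of_sum_eq_zero hX.1 hX.2 hx.1 hy.1 hxy).trans
    (Finset.eq_insert_insert_neg_of_sum_eq_zero hY.1 hY.2 hx.2 hy.2 hxy).symm)

variable (G) in
theorem card_mul_card_le_six_mul_card_zeroSumTriples :
    Fintype.card G * Fintype.card G ≤
      6 * (zeroSumTriples G).card + 3 * Fintype.card G := by
  let S : Finset (G × G) := {p | p.1 ≠ p.2 ∧ p.1 ≠ -p.1 - p.2 ∧ p.2 ≠ -p.1 - p.2}
  have hS : S.card ≤ 6 * (zeroSumTriples G).card := by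
    refine Finset.card_le_mul_card_image_of_maps_to (f := fun p => {p.1, p.2, -p.1 - p.2}) ?_ 6 ?_
    · rintro ⟨a, b⟩ hp
      obtain ⟨hab, hac, hbc⟩ : a ≠ b ∧ a ≠ -a - b ∧ b ≠ -a - b := by simpa [S] using hp
      refine mem_zeroSumTriples.2 ⟨Finset.card_eq_three.2 ⟨a, b, _, hab, hac, hbc, rfl⟩, ?_⟩
      rw [Finset.sum_insert (by simp [hab, hac]), Finset.sum_pair hbc]
      abel
    · intro X hX
      have h : X.offDiag.card = 6 := by
        rw [Finset.offDiag_card, (mem_zeroSumTriples.1 hX).1]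
      rw [← h]
      refine Finset.card_le_card ?_
      rintro ⟨a, b⟩ hp
      obtain ⟨hpS, rfl⟩ := Finset.mem_filter.1 hp
      have hab : a ≠ b := (Finset.mem_filter.1 hpS).2.1
      simp [hab]
  have hSc : Sᶜ.card ≤ 3 * Fintype.card G := by
    let D : Finset (G × G) := Finset.univ.image (fun g => (g, g))
    let A : Finset (G × G) := Finset.univ.image (fun g => (g, -g - g))
    let B : Finset (G × G) := Finset.univ.image (fun g => (-g - g, g))
    have hsub : Sᶜ ⊆ D ∪ A ∪ B := by
      rintro ⟨a, b⟩ hp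
      have hp' : a = b ∨ a = -a - b ∨ b = -a - b := by
        have := hp
        simp only [S, Finset.mem_compl, Finset.mem_filter, Finset.mem_univ, true_and] at this
        tauto
      simp only [D, A, B, Finset.mem_union, Finset.mem_image, Finset.mem_univ, true_and,
        Prod.mk.injEq]
      rcases hp' with h | h | h
      · exact Or.inl (Or.inl ⟨a, rfl, h⟩)
      · refine Or.inl (Or.inr ⟨a, rfl, ?_⟩)
        nth_rewrite 2 [h]
        abel
      · refine Or.inr ⟨b, ?_, rfl⟩
        nth_rewrite 2 [h]
        abel
    have hD : D.card ≤ Fintype.card G := Finset.card_image_le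
    have hA : A.card ≤ Fintype.card G := Finset.card_image_le
    have hB : B.card ≤ Fintype.card G := Finset.card_image_le
    have h₁ := Finset.card_le_card hsub
    have h₂ := Finset.card_union_le (D ∪ A) B
    have h₃ := Finset.card_union_le D A
    omega
  rw [← Fintype.card_prod, ← Finset.card_add_card_compl S]
  exact Nat.add_le_add hS hSc

end ZeroSumTriples


/-- The quadratic lower-bound construction in the proof of Theorem 3.6 of
"How to draw tropical planes": for every `n ≥ 1` there is a family of 3-element subsets
of `Fin n`, pairwise intersecting in at most one element (a stable set of the edge
graph of the hypersimplex `Δ(3,n)`), whose size `|F|` satisfies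
`24·|F| ≥ (n−1)(n−3)` as rational numbers. -/
theorem exists_large_stable_family_of_triples (n : ℕ) (hn : 1 ≤ n) :
    ∃ F : Finset (Finset (Fin n)),
      (∀ X ∈ F, X.card = 3) ∧
      (∀ X ∈ F, ∀ Y ∈ F, X ≠ Y → (X ∩ Y).card ≤ 1) ∧
      ((n : ℚ) - 1) * ((n : ℚ) - 3) ≤ 24 * (F.card : ℚ) := by
  have : NeZero n := ⟨by omega⟩
  refine ⟨zeroSumTriples (Fin n), fun X hX => (mem_zeroSumTriples.1 hX).1,
    fun X hX Y hY => card_inter_le_one_of_mem_zeroSumTriples hX hY, ?_⟩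
  have h := card_mul_card_le_six_mul_card_zeroSumTriples (Fin n)
  rw [Fintype.card_fin] at h
  have hq : (n : ℚ) * n ≤ 6 * ((zeroSumTriples (Fin n)).card : ℚ) + 3 * n := by
    exact_mod_cast h
  obtain hn3 | hn3 := lt_or_ge n 3
  · have hF : (0 : ℚ) ≤ (zeroSumTriples (Fin n)).card := Nat.cast_nonneg _
    interval_cases n <;> norm_num
    linarith
  · have hn3' : (3 : ℚ) ≤ n := by exact_mod_cast hn3
    nlinarith
end

section
/- Let R be a commutative ring and d ≥ 2. Fix vectors w : Fin (d−2) → (Fin d → R), and for a, b : Fin d → R let D(a,b) denote the determinant of the d×d matrix over R whose first d−2 columns are w(0), …, w(d−3) and whose last two columns are a and b. Then for all x, y, z, t : Fin d → R, D(x,y)·D(z,t) − D(x,z)·D(y,t) + D(x,t)·D(y,z) = 0. -/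
/-- Given `d ≥ 2`, fixed columns `w 0, …, w (d-3)` and two further columns `a`, `b` in
`Fin d → R`, this is the determinant of the `d × d` matrix whose columns are
`w 0, …, w (d-3), a, b` in this order. -/
def plueckerMinor {R : Type*} [CommRing R] {d : ℕ} (hd : 2 ≤ d)
    (w : Fin (d - 2) → (Fin d → R)) (a b : Fin d → R) : R :=
  Matrix.det (Matrix.of fun (i j : Fin d) =>
    Fin.append w ![a, b] (Fin.cast (Nat.sub_add_cancel hd).symm j) i)

open Matrix in
/-- The exchange relation between two square matrices: a column `z` of the second determinant
is exchanged with each column of the first. -/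
theorem Matrix.det_mul_det_updateCol {n R : Type*} [Fintype n] [DecidableEq n] [CommRing R]
    (A B : Matrix n n R) (p : n) (z : n → R) :
    A.det * (B.updateCol p z).det =
      ∑ j, (A.updateCol j z).det * (B.updateCol p (A.col j)).det := by
  have h : A.det • z = ∑ j, A.cramer z j • A.col j := by
    rw [← mulVec_cramer]
    ext i
    simp [mulVec, dotProduct, mul_comm]
  have key := congrArg (fun v => B.cramer v p) h
  simp only [map_smul, map_sum, Finset.sum_apply, Pi.smul_apply, smul_eq_mul] at key
  simpa only [cramer_apply] using key

/-- The three-term Plücker relation, for the determinants obtained from a fixed square matrix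
by replacing two of its columns. -/
theorem Matrix.det_updateCol_updateCol_pluecker {n R : Type*} [Fintype n] [DecidableEq n]
    [CommRing R] (M : Matrix n n R) {p q : n} (hpq : p ≠ q) (x y z t : n → R) :
    ((M.updateCol p x).updateCol q y).det * ((M.updateCol p z).updateCol q t).det
      - ((M.updateCol p x).updateCol q z).det * ((M.updateCol p y).updateCol q t).det
      + ((M.updateCol p x).updateCol q t).det * ((M.updateCol p y).updateCol q z).det = 0 := by
  have comm (a b : n → R) :
      (M.updateCol q b).updateCol p a = (M.updateCol p a).updateCol q b := by
    ext i j
    simp only [Matrix.updateCol_apply]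
    grind
  have swap (a b : n → R) : ((M.updateCol p a).updateCol q b).det =
      -((M.updateCol p b).updateCol q a).det := by
    have h := Matrix.det_permute' (Equiv.swap p q) ((M.updateCol p b).updateCol q a)
    rw [Equiv.Perm.sign_swap hpq] at h
    have key : ((M.updateCol p a).updateCol q b) =
        ((M.updateCol p b).updateCol q a).submatrix id (Equiv.swap p q) := by
      ext i j
      simp only [Matrix.updateCol_apply, Matrix.submatrix_apply, Equiv.swap_apply_def, id]
      grind
    rw [key, h]
    simp
  have h := Matrix.det_mul_det_updateCol ((M.updateCol p x).updateCol q y) (M.updateCol q t) p z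
  rw [Fintype.sum_eq_add p q hpq] at h
  · have hp : ((M.updateCol p x).updateCol q y).col p = x := by
      ext i; simp [hpq]
    have hq : ((M.updateCol p x).updateCol q y).col q = y := by
      ext i; simp
    have hz : ((M.updateCol p x).updateCol q y).updateCol p z =
        (M.updateCol p z).updateCol q y := by
      ext i j
      simp only [Matrix.updateCol_apply]
      grind
    have hzq : ((M.updateCol p x).updateCol q y).updateCol q z =
        (M.updateCol p x).updateCol q z := by
      ext i j
      simp only [Matrix.updateCol_apply]
      grind
    rw [hp, hq, hz, hzq, comm, comm, comm, swap z y] at h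
    linear_combination h
  · rintro j ⟨hjp, hjq⟩
    rw [Matrix.det_zero_of_column_eq (M := (M.updateCol q t).updateCol p _) hjp, mul_zero]
    intro i
    simp [hjp, hjq]

/-- A maximal minor `plueckerMinor hd w a b` is obtained by replacing the last two columns of a
square matrix which depends only on `w`. -/
theorem plueckerMinor_eq_det_updateCol {R : Type*} [CommRing R] {d : ℕ} (hd : 2 ≤ d)
    (w : Fin (d - 2) → (Fin d → R)) (a b : Fin d → R) :
    plueckerMinor hd w a b =
      (((Matrix.of fun i j : Fin d =>
        Fin.append w (0 : Fin 2 → Fin d → R) (Fin.cast (Nat.sub_add_cancel hd).symm j) i).updateCol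
          (Fin.cast (Nat.sub_add_cancel hd) (Fin.natAdd (d - 2) 0)) a).updateCol
          (Fin.cast (Nat.sub_add_cancel hd) (Fin.natAdd (d - 2) 1)) b).det := by
  unfold plueckerMinor
  congr 1
  ext i j
  obtain ⟨j, rfl⟩ := (finCongr (Nat.sub_add_cancel hd)).surjective j
  induction j using Fin.addCases with
  | left j =>
    have h0 : j.val ≠ d - 2 := j.isLt.ne
    have h1 : j.val ≠ d - 2 + 1 := by omega
    simp [Fin.ext_iff, h0, h1]
  | right j => fin_cases j <;> simp [Fin.ext_iff]

/-- The three-term Plücker relation (equation (2.1) of "How to draw tropical planes")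
among the maximal minors of a `d × n` matrix over a commutative ring. -/
theorem three_term_pluecker_relation {R : Type*} [CommRing R] {d : ℕ} (hd : 2 ≤ d)
    (w : Fin (d - 2) → (Fin d → R)) (x y z t : Fin d → R) :
    plueckerMinor hd w x y * plueckerMinor hd w z t
      - plueckerMinor hd w x z * plueckerMinor hd w y t
      + plueckerMinor hd w x t * plueckerMinor hd w y z = 0 := by
  simp only [plueckerMinor_eq_det_updateCol]
  exact Matrix.det_updateCol_updateCol_pluecker _ (by simp [Fin.ext_iff]) x y z t
end

section
/- Let d ≤ n be natural numbers. The convex hull in Fin n → ℝ of the set of indicator vectors of d-element subsets of Fin n (the vectors e_X with coordinates 1 on X and 0 off X, for X ⊆ Fin n with |X| = d) equals the set { x : Fin n → ℝ | (∀ i, 0 ≤ x i ∧ x i ≤ 1) ∧ ∑ i, x i = d }. -/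
/-- If `x` has entries in `[0,1]` and integral coordinate sum, a fractional entry of `x` is
accompanied by another one. -/
lemma exists_ne_fractional_of_sum_eq_natCast {ι : Type*} [Fintype ι] [DecidableEq ι]
    {x : ι → ℝ} {d : ℕ} (hx : ∀ i, 0 ≤ x i ∧ x i ≤ 1) (hsum : ∑ i, x i = d)
    {i : ι} (h0 : 0 < x i) (h1 : x i < 1) : ∃ j, j ≠ i ∧ 0 < x j ∧ x j < 1 := by
  by_contra! h
  have hrest : ∑ j ∈ Finset.univ.erase i, x j
      = (((Finset.univ.erase i).filter fun j => 0 < x j).card : ℝ) := by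
    rw [Finset.card_filter, Nat.cast_sum]
    refine Finset.sum_congr rfl fun j hj => ?_
    split_ifs with hpos
    · simpa using le_antisymm (hx j).2 (h j (Finset.ne_of_mem_erase hj) hpos)
    · simpa using le_antisymm (not_lt.1 hpos) (hx j).1
  rw [← Finset.add_sum_erase _ _ (Finset.mem_univ i), hrest] at hsum
  set m := ((Finset.univ.erase i).filter fun j => 0 < x j).card
  have hlt : m < d := by
    have : (m : ℝ) < d := by linarith
    exact_mod_cast this
  have hgt : d < m + 1 := by
    have : (d : ℝ) < m + 1 := by linarith
    exact_mod_cast this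
  omega

/-- The extreme points of the slice `∑ i, x i = d` of the unit cube have entries in `{0, 1}`. -/
lemma eq_zero_or_one_of_mem_extremePoints_cube_slice {ι : Type*} [Fintype ι] {d : ℕ} {x : ι → ℝ}
    (hx : x ∈ Set.extremePoints ℝ {x : ι → ℝ | (∀ i, 0 ≤ x i ∧ x i ≤ 1) ∧ ∑ i, x i = d})
    (i : ι) : x i = 0 ∨ x i = 1 := by
  classical
  obtain ⟨⟨hbox, hsum⟩, hext⟩ := mem_extremePoints.1 hx
  by_contra! hi
  have hi0 : 0 < x i := lt_of_le_of_ne (hbox i).1 hi.1.symm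
  have hi1 : x i < 1 := lt_of_le_of_ne (hbox i).2 hi.2
  obtain ⟨j, hji, hj0, hj1⟩ := exists_ne_fractional_of_sum_eq_natCast hbox hsum hi0 hi1
  obtain ⟨ε, hε, hεlt⟩ : ∃ ε > 0, ε < min (min (x i) (1 - x i)) (min (x j) (1 - x j)) :=
    exists_between (by simp [*])
  simp only [lt_min_iff] at hεlt
  let v : ι → ℝ := Pi.single i 1 - Pi.single j 1
  have hvi : v i = 1 := by simp [v, hji.symm]
  have hmem : ∀ t : ℝ, |t| ≤ ε →
      x + t • v ∈ {x : ι → ℝ | (∀ i, 0 ≤ x i ∧ x i ≤ 1) ∧ ∑ i, x i = d} := by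
    intro t ht
    obtain ⟨ht1, ht2⟩ := abs_le.1 ht
    refine ⟨fun k => ?_, ?_⟩
    · by_cases hki : k = i
      · subst hki
        simp only [Pi.add_apply, Pi.smul_apply, hvi, smul_eq_mul]
        constructor <;> linarith
      · by_cases hkj : k = j
        · subst hkj
          have hvk : v k = -1 := by simp [v, hji]
          simp only [Pi.add_apply, Pi.smul_apply, hvk, smul_eq_mul]
          constructor <;> linarith
        · simpa [v, hki, hkj] using hbox k
    · simp [v, Finset.sum_add_distrib, ← Finset.mul_sum, hsum]
  have hseg : x ∈ openSegment ℝ (x + ε • v) (x + (-ε) • v) :=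
    ⟨1 / 2, 1 / 2, by norm_num, by norm_num, by norm_num, by module⟩
  have heq := congrFun (hext _ (hmem ε (abs_of_pos hε).le) _
    (hmem (-ε) (by rw [abs_neg, abs_of_pos hε])) hseg).1 i
  simp only [Pi.add_apply, Pi.smul_apply, hvi, smul_eq_mul] at heq
  linarith

/-- Section 4 of "How to draw tropical planes": the hypersimplex `Δ(d,n)`, the convex
hull of the indicator vectors of the `d`-element subsets of `[n]`, is the intersection
of the unit cube `[0,1]^n` with the affine hyperplane `∑ x_i = d`. -/
theorem hypersimplex_eq_cube_inter_hyperplane (n d : ℕ) (hdn : d ≤ n) :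
    convexHull ℝ
        {v : Fin n → ℝ | ∃ X : Finset (Fin n), X.card = d ∧
          v = fun i => if i ∈ X then (1 : ℝ) else 0}
      = {x : Fin n → ℝ | (∀ i, 0 ≤ x i ∧ x i ≤ 1) ∧ ∑ i, x i = d} := by
  have hslice : {x : Fin n → ℝ | (∀ i, 0 ≤ x i ∧ x i ≤ 1) ∧ ∑ i, x i = d}
      = Set.Icc 0 1 ∩ {x | ∑ i, x i = (d : ℝ)} := by
    ext x
    simp [Pi.le_def, forall_and]
  have hconv : Convex ℝ {x : Fin n → ℝ | (∀ i, 0 ≤ x i ∧ x i ≤ 1) ∧ ∑ i, x i = d} := by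
    rw [hslice]
    refine (convex_Icc 0 1).inter (convex_hyperplane ⟨fun x y => ?_, fun c x => ?_⟩ _)
    · simp [Finset.sum_add_distrib]
    · simp [Finset.mul_sum]
  have hcomp : IsCompact {x : Fin n → ℝ | (∀ i, 0 ≤ x i ∧ x i ≤ 1) ∧ ∑ i, x i = d} := by
    rw [hslice]
    exact isCompact_Icc.inter_right (isClosed_eq (by fun_prop) continuous_const)
  refine (convexHull_min ?_ hconv).antisymm ?_
  · rintro _ ⟨X, hX, rfl⟩
    refine ⟨fun i => ?_, by simp [hX]⟩
    dsimp only
    split_ifs <;> norm_num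
  · have hfin : {v : Fin n → ℝ | ∃ X : Finset (Fin n), X.card = d ∧
        v = fun i => if i ∈ X then (1 : ℝ) else 0}.Finite :=
      (Set.finite_range fun (X : Finset (Fin n)) i => if i ∈ X then (1 : ℝ) else 0).subset
        fun _ ⟨X, _, hv⟩ => ⟨X, hv.symm⟩
    rw [← closure_convexHull_extremePoints hcomp hconv]
    refine closure_minimal (convexHull_mono fun x hx => ?_) (hfin.isClosed_convexHull ℝ)
    have h01 := eq_zero_or_one_of_mem_extremePoints_cube_slice hx
    have hind : x = fun i => if i ∈ Finset.univ.filter (fun i => x i = 1) then (1 : ℝ) else 0 := by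
      ext i
      rcases h01 i with h | h <;> simp [h]
    refine ⟨_, ?_, hind⟩
    have hsum := hx.1.2
    rw [hind] at hsum
    simpa only [Finset.sum_ite_mem, Finset.univ_inter, Finset.sum_const, nsmul_eq_mul, mul_one,
      Nat.cast_inj] using hsum
end

section
/- Let X be the generic 3×9 matrix over ℤ, i.e., the matrix with entries the variables of the multivariate polynomial ring MvPolynomial (Fin 3 × Fin 9) ℤ, and for column labels a, b, c ∈ {1,…,9} let [abc] denote the determinant of the 3×3 submatrix of X on columns a, b, c (taken in increasing order). Then the polynomial [289]·[389]·[489]·[569]·[589]·[167] − [189]·[389]·[489]·[569]·[679]·[258] + [189]·[289]·[569]·[589]·[678]·[349] lies in the ideal of MvPolynomial (Fin 3 × Fin 9) ℤ generated by the nine minors [123], [148], [159], [247], [269], [357], [368], [456], [789]. -/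
/-- The generic 3×9 matrix over ℤ, whose entries are the variables of the polynomial
ring `MvPolynomial (Fin 3 × Fin 9) ℤ`. Columns are labeled `1,…,9`, identified with
`Fin 9` via `1 ↦ 0, …, 9 ↦ 8`. -/
noncomputable def genericMatrix : Matrix (Fin 3) (Fin 9) (MvPolynomial (Fin 3 × Fin 9) ℤ) :=
  fun i j => MvPolynomial.X (i, j)

/-- The maximal minor `[abc]` of the generic 3×9 matrix: the determinant of the 3×3
submatrix on columns `a`, `b`, `c` (taken in this order). -/
noncomputable def minor (a b c : Fin 9) : MvPolynomial (Fin 3 × Fin 9) ℤ :=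
  Matrix.det (Matrix.of fun (i j : Fin 3) => genericMatrix i (![a, b, c] j))

/-- The Pappus ideal `I_M`: the ideal generated by the nine maximal minors indexed by
the lines `123, 148, 159, 247, 269, 357, 368, 456, 789` of the Pappus configuration
(in 0-based labels). -/
noncomputable def pappusIdeal : Ideal (MvPolynomial (Fin 3 × Fin 9) ℤ) :=
  Ideal.span
    {minor 0 1 2, minor 0 3 7, minor 0 4 8, minor 1 3 6, minor 1 5 8,
      minor 2 4 6, minor 2 5 7, minor 3 4 5, minor 6 7 8}

/-- The algebraic witness from Section 6 of "How to draw tropical planes": the trinomial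
`[289][389][489][569][589][167] − [189][389][489][569][679][258] + [189][289][569][589][678][349]`
lies in the Pappus ideal (labels written 1-based in the paper, 0-based here). -/
theorem pappus_trinomial_mem_ideal :
    minor 1 7 8 * minor 2 7 8 * minor 3 7 8 * minor 4 5 8 * minor 4 7 8 * minor 0 5 6
      - minor 0 7 8 * minor 2 7 8 * minor 3 7 8 * minor 4 5 8 * minor 5 6 8 * minor 1 4 7
      + minor 0 7 8 * minor 1 7 8 * minor 4 5 8 * minor 4 7 8 * minor 5 6 7 * minor 2 3 8
      ∈ pappusIdeal := by
  have plucker_145678 :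
      -minor 1 4 7 * minor 5 6 8 + minor 1 5 8 * minor 4 6 7 - minor 1 6 7 * minor 4 5 8
      + minor 1 4 6 * minor 5 7 8 = 0 := by
    simp only [minor, Matrix.det_fin_three, Matrix.of_apply, Matrix.cons_val]
    ring
  have plucker_04578 :
      minor 0 4 8 * minor 5 7 8 - minor 0 5 8 * minor 4 7 8 + minor 0 7 8 * minor 4 5 8 = 0 := by
    simp only [minor, Matrix.det_fin_three, Matrix.of_apply, Matrix.cons_val]
    ring
  have plucker_13678 :
      -minor 1 3 7 * minor 6 7 8 + minor 1 6 7 * minor 3 7 8 - minor 1 7 8 * minor 3 6 7 = 0 := by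
    simp only [minor, Matrix.det_fin_three, Matrix.of_apply, Matrix.cons_val]
    ring
  have plucker_235678 :
      minor 2 6 8 * minor 3 5 7 - minor 2 5 7 * minor 3 6 8 + minor 2 3 8 * minor 5 6 7
      + minor 2 3 6 * minor 5 7 8 = 0 := by
    simp only [minor, Matrix.det_fin_three, Matrix.of_apply, Matrix.cons_val]
    ring
  have plucker_134678 :
      minor 1 4 6 * minor 3 7 8 - minor 1 7 8 * minor 3 4 6 - minor 1 3 6 * minor 4 7 8
      + minor 1 3 4 * minor 6 7 8 = 0 := by
    simp only [minor, Matrix.det_fin_three, Matrix.of_apply, Matrix.cons_val]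
    ring
  have plucker_234678 :
      minor 2 3 6 * minor 4 7 8 + minor 2 7 8 * minor 3 4 6 - minor 2 4 6 * minor 3 7 8
      - minor 2 3 4 * minor 6 7 8 = 0 := by
    simp only [minor, Matrix.det_fin_three, Matrix.of_apply, Matrix.cons_val]
    ring
  have plucker_035678 :
      -minor 0 6 8 * minor 3 5 7 - minor 0 3 7 * minor 5 6 8 + minor 0 5 8 * minor 3 6 7
      + minor 0 5 6 * minor 3 7 8 = 0 := by
    simp only [minor, Matrix.det_fin_three, Matrix.of_apply, Matrix.cons_val]
    ring
  have plucker_02678 :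
      minor 0 2 8 * minor 6 7 8 - minor 0 6 8 * minor 2 7 8 + minor 0 7 8 * minor 2 6 8 = 0 := by
    simp only [minor, Matrix.det_fin_three, Matrix.of_apply, Matrix.cons_val]
    ring
  have key :
      minor 1 7 8 * minor 2 7 8 * minor 3 7 8 * minor 4 5 8 * minor 4 7 8 * minor 0 5 6
      - minor 0 7 8 * minor 2 7 8 * minor 3 7 8 * minor 4 5 8 * minor 5 6 8 * minor 1 4 7
      + minor 0 7 8 * minor 1 7 8 * minor 4 5 8 * minor 4 7 8 * minor 5 6 7 * minor 2 3 8 =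
        minor 4 5 8 * (minor 5 6 8 * minor 1 7 8 * minor 2 7 8 * minor 4 7 8) * minor 0 3 7 +
        minor 4 5 8 * (-minor 5 7 8 * minor 1 6 7 * minor 2 7 8 * minor 3 7 8) * minor 0 4 8 +
        minor 4 5 8 * (-minor 4 7 8 * minor 0 7 8 * minor 2 7 8 * minor 5 7 8) * minor 1 3 6 +
        minor 4 5 8 * (-minor 4 6 7 * minor 0 7 8 * minor 2 7 8 * minor 3 7 8) * minor 1 5 8 +
        minor 4 5 8 * (-minor 3 7 8 * minor 0 7 8 * minor 1 7 8 * minor 5 7 8) * minor 2 4 6 +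
        minor 4 5 8 * (minor 3 6 8 * minor 0 7 8 * minor 1 7 8 * minor 4 7 8) * minor 2 5 7 +
        minor 4 5 8 * (
          minor 1 3 7 * minor 0 5 8 * minor 2 7 8 * minor 4 7 8
          + minor 1 3 4 * minor 0 7 8 * minor 2 7 8 * minor 5 7 8
          - minor 2 3 4 * minor 0 7 8 * minor 1 7 8 * minor 5 7 8
          + minor 0 2 8 * minor 1 7 8 * minor 3 5 7 * minor 4 7 8) * minor 6 7 8 := by
    linear_combination minor 4 5 8 * (
      minor 0 7 8 * minor 2 7 8 * minor 3 7 8 * plucker_145678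
      + minor 1 6 7 * minor 2 7 8 * minor 3 7 8 * plucker_04578
      + minor 0 5 8 * minor 2 7 8 * minor 4 7 8 * plucker_13678
      + minor 0 7 8 * minor 1 7 8 * minor 4 7 8 * plucker_235678
      - minor 0 7 8 * minor 2 7 8 * minor 5 7 8 * plucker_134678
      - minor 0 7 8 * minor 1 7 8 * minor 5 7 8 * plucker_234678
      + minor 1 7 8 * minor 2 7 8 * minor 4 7 8 * plucker_035678
      - minor 1 7 8 * minor 3 5 7 * minor 4 7 8 * plucker_02678)
  rw [key]
  refine Ideal.add_mem _ (Ideal.add_mem _ (Ideal.add_mem _ (Ideal.add_mem _ (Ideal.add_mem _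
    (Ideal.add_mem _ (Ideal.mul_mem_left _ _ ?_) (Ideal.mul_mem_left _ _ ?_))
    (Ideal.mul_mem_left _ _ ?_)) (Ideal.mul_mem_left _ _ ?_)) (Ideal.mul_mem_left _ _ ?_))
    (Ideal.mul_mem_left _ _ ?_)) (Ideal.mul_mem_left _ _ ?_) <;>
    exact Ideal.subset_span (by simp)
end
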